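/- arXiv:1909.13715 — 2 statements merged into one kernel-verified Lean document; each statement's English description precedes it below -/
import Mathlib

section
/- Let H be a Hilbert space, D a subset of a normed space, and C : D ⇒ H defined by C(p) = {x : ⟨x, g_i(p)⟩ = f_i(p), i ∈ I_1; ⟨x, g_i(p)⟩ ≤ f_i(p), i ∈ I_2} with f_i, g_i locally Lipschitz. Suppose RCRCQ holds at (p̄, x̄) ∈ gph C (i.e., for some neighbourhood U of p̄, for every index set J with I_1 ⊂ J ⊂ I_{p̄}(x̄), rank{g_i(p) : i ∈ J} = rank{g_i(p̄) : i ∈ J} for all p ∈ U) and x̄ ∈ liminf_{p→p̄} C(p). Then for the projection P(v,p) of v onto C(p), there exist a constant ℓ⁰ > 0 and neighbourhoods W of v̄ and U of p̄ such that ‖(v₁ − v₂) − 2[P(v₁,p₁) − P(v₂,p₂)]‖ ≤ ‖v₁ − v₂‖ + ℓ⁰‖p₁ − p₂‖^{1/2} for all (v₁,p₁),(v₂,p₂) ∈ W × U, where x̄ = P(v̄, p̄). -/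
open RealInnerProductSpace

lemma aux_carath {ι H : Type*} [DecidableEq ι] [AddCommGroup H] [Module ℝ H] (g : ι → H)
    (B : Finset ι) (hB : LinearIndepOn ℝ g (B : Set ι)) (S : Finset ι) :
    B ⊆ S → ∀ l : ι → ℝ, (∀ i ∈ S, i ∉ B → 0 ≤ l i) →
    ∃ S' ⊆ S, B ⊆ S' ∧ LinearIndepOn ℝ g (S' : Set ι) ∧ ∃ m : ι → ℝ,
      (∀ i ∈ S', i ∉ B → 0 ≤ m i) ∧ ∑ i ∈ S', m i • g i = ∑ i ∈ S, l i • g i := by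
  induction S using Finset.strongInduction with
  | H S ih =>
  intro hBS l hl
  by_cases hS : LinearIndepOn ℝ g (S : Set ι)
  · exact ⟨S, subset_rfl, hBS, hS, l, hl, rfl⟩
  have h1 : ∃ c : ι → ℝ, ∑ i ∈ S, c i • g i = 0 ∧ ∃ i ∈ S, i ∉ B ∧ 0 < c i := by
    rw [linearIndepOn_finset_iff] at hS
    push Not at hS
    obtain ⟨c, hc, j, hj, hcj⟩ := hS
    have : ∃ i ∈ S, i ∉ B ∧ c i ≠ 0 := by
      by_contra! hcon
      have h0 : ∑ i ∈ B, c i • g i = 0 := by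
        rw [← hc]
        apply Finset.sum_subset hBS
        intro i hi hiB
        rw [hcon i hi hiB, zero_smul]
      rw [linearIndepOn_finset_iff] at hB
      by_cases hjB : j ∈ B
      · exact hcj (hB c h0 j hjB)
      · exact hcj (hcon j hj hjB)
    obtain ⟨i, hi, hiB, hci⟩ := this
    rcases lt_or_gt_of_ne hci with h | h
    · refine ⟨fun i => - c i, ?_, i, hi, hiB, by simpa using h⟩
      simp [Finset.sum_neg_distrib, hc]
    · exact ⟨c, hc, i, hi, hiB, h⟩
  obtain ⟨c, hc, i0, hi0, hi0B, hci0⟩ := h1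
  obtain ⟨k, hk, hmin⟩ := Finset.exists_min_image (S.filter (fun i => i ∉ B ∧ 0 < c i))
    (fun i => l i / c i) ⟨i0, by simp [hi0, hi0B, hci0]⟩
  simp only [Finset.mem_filter] at hk hmin
  obtain ⟨hkS, hkB, hck⟩ := hk
  have hBS' : B ⊆ S.erase k := fun i hi => Finset.mem_erase.2 ⟨fun h => hkB (h ▸ hi), hBS hi⟩
  obtain ⟨S', hS', hBS'', hind, m, hm, hsum⟩ := ih (S.erase k) (Finset.erase_ssubset hkS) hBS'
    (fun i => l i - l k / c k * c i) (by
      intro i hi hiB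
      have hiS := Finset.mem_of_mem_erase hi
      have hr : 0 ≤ l k / c k := div_nonneg (hl k hkS hkB) hck.le
      rcases le_or_gt (c i) 0 with h | h
      · have := hl i hiS hiB
        nlinarith
      · have := hmin i ⟨hiS, hiB, h⟩
        rw [le_div_iff₀ h] at this
        linarith)
  refine ⟨S', hS'.trans (Finset.erase_subset _ _), hBS'', hind, m, hm, ?_⟩
  rw [hsum]
  have h2 : ∑ i ∈ S, (l i - l k / c k * c i) • g i = ∑ i ∈ S, l i • g i := by
    simp only [sub_smul, mul_smul, Finset.sum_sub_distrib]
    rw [← Finset.smul_sum, hc]; simp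
  rw [← h2, ← Finset.add_sum_erase S _ hkS]
  have : l k - l k / c k * c k = 0 := by field_simp; ring
  rw [this]; simp

lemma aux_inj {ι H : Type*} [AddCommGroup H] [Module ℝ H] (g : ι → H) (S : Finset ι)
    (hS : LinearIndepOn ℝ g (S : Set ι)) :
    ∃ T : (S → ℝ) →ₗ[ℝ] H, Function.Injective T ∧ ∀ m, T m = ∑ i : S, m i • g i := by
  refine ⟨Fintype.linearCombination ℝ (fun i : S => g i), ?_, ?_⟩
  · have : LinearIndependent ℝ (fun i : S => g i) := hS
    exact (linearIndependent_iff_injective_fintypeLinearCombination).1 this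
  · intro m; simp [Fintype.linearCombination_apply]

lemma aux_bound {ι H : Type*} [NormedAddCommGroup H] [NormedSpace ℝ H] (g : ι → H)
    (S : Finset ι) (hS : LinearIndepOn ℝ g (S : Set ι)) :
    ∃ c > (0 : ℝ), ∀ l : ι → ℝ, c * ∑ i ∈ S, |l i| ≤ ‖∑ i ∈ S, l i • g i‖ := by
  obtain ⟨T, hT, hTm⟩ := aux_inj g S hS
  obtain ⟨K, hK, hKT⟩ := LinearMap.exists_antilipschitzWith T (LinearMap.ker_eq_bot.2 hT)
  refine ⟨1 / ((S.card + 1) * K), by positivity, fun l => ?_⟩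
  have h1 := hKT.le_mul_dist (fun i : S => l i) 0
  rw [map_zero, dist_zero_right, dist_zero_right, hTm, Finset.sum_coe_sort S (fun i => l i • g i)] at h1
  have h2 : ∑ i ∈ S, |l i| ≤ S.card * ‖(fun i : S => l i)‖ := by
    rw [← nsmul_eq_mul]
    apply Finset.sum_le_card_nsmul
    intro i hi
    exact norm_le_pi_norm (fun i : S => l i) ⟨i, hi⟩
  rw [div_mul_eq_mul_div, one_mul, div_le_iff₀ (by positivity)]
  have h3 := norm_nonneg (fun i : S => l i)
  have h4 : (S.card : ℝ) * ‖(fun i : S => l i)‖ ≤ (S.card + 1) * (K * ‖∑ i ∈ S, l i • g i‖) := by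
    gcongr
    linarith
  linarith

lemma aux_closed {ι H : Type*} [DecidableEq ι] [NormedAddCommGroup H] [NormedSpace ℝ H]
    (g : ι → H) (B S : Finset ι) (hB : LinearIndepOn ℝ g (B : Set ι)) (hBS : B ⊆ S) :
    IsClosed {w : H | ∃ l : ι → ℝ, (∀ i ∈ S, i ∉ B → 0 ≤ l i) ∧ ∑ i ∈ S, l i • g i = w} := by
  classical
  have heq : {w : H | ∃ l : ι → ℝ, (∀ i ∈ S, i ∉ B → 0 ≤ l i) ∧ ∑ i ∈ S, l i • g i = w} =
      ⋃ S' ∈ S.powerset.filter (fun S' : Finset ι => LinearIndepOn ℝ g (S' : Set ι)),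
        {w : H | ∃ l : ι → ℝ, (∀ i ∈ S', i ∉ B → 0 ≤ l i) ∧ ∑ i ∈ S', l i • g i = w} := by
    ext w
    simp only [Set.mem_iUnion, Set.mem_ofPred_eq, Finset.mem_filter, Finset.mem_powerset]
    constructor
    · rintro ⟨l, hl, hw⟩
      obtain ⟨S', h1, h2, h3, m, hm, hs⟩ := aux_carath g B hB S hBS l hl
      exact ⟨S', ⟨h1, h3⟩, m, hm, hs.trans hw⟩
    · rintro ⟨S', ⟨h1, h3⟩, m, hm, hs⟩
      refine ⟨fun i => if i ∈ S' then m i else 0, ?_, ?_⟩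
      · intro i hi hiB
        dsimp only
        split_ifs with h
        · exact hm i h hiB
        · exact le_rfl
      · rw [← hs, ← Finset.sum_subset h1]
        · apply Finset.sum_congr rfl
          intro i hi
          simp [hi]
        · intro i _ hi
          simp [hi]
  rw [heq]
  apply isClosed_biUnion_finset
  intro S' hS'
  simp only [Finset.mem_filter] at hS'
  obtain ⟨T, hT, hTm⟩ := aux_inj g S' hS'.2
  have hcl : IsClosed {m : S' → ℝ | ∀ i : S', (i : ι) ∉ B → 0 ≤ m i} := by
    simp only [Set.ofPred_forall]
    refine isClosed_iInter fun i => isClosed_iInter fun _ => ?_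
    exact isClosed_le continuous_const (continuous_apply i)
  have := (LinearMap.isClosedEmbedding_of_injective (LinearMap.ker_eq_bot.2 hT)).isClosedMap _ hcl
  convert this using 1
  ext w
  simp only [Set.mem_ofPred_eq, Set.mem_image]
  constructor
  · rintro ⟨l, hl, hw⟩
    refine ⟨fun i => l i, fun i hi => hl i i.2 hi, ?_⟩
    rw [hTm, ← hw, Finset.sum_coe_sort S' (fun i => l i • g i)]
  · rintro ⟨m, hm, hw⟩
    refine ⟨fun i => if h : i ∈ S' then m ⟨i, h⟩ else 0, ?_, ?_⟩
    · intro i hi hiB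
      simp only [hi, dite_true]
      exact hm ⟨i, hi⟩ hiB
    · rw [← hw, hTm, ← Finset.sum_coe_sort S']
      simp

lemma aux_kkt {ι H : Type*} [DecidableEq ι] [NormedAddCommGroup H] [InnerProductSpace ℝ H]
    [CompleteSpace H] (g : ι → H) (f : ι → ℝ) (I₁ I₂ B : Finset ι) 
    (hB : LinearIndepOn ℝ g (B : Set ι)) (hBI : B ⊆ I₁)
    (hspan : ∀ i ∈ I₁, g i ∈ Submodule.span ℝ (g '' (B : Set ι))) (v x : H)
    (hx1 : ∀ i ∈ I₁, ⟪x, g i⟫ = f i) (hx2 : ∀ i ∈ I₂, ⟪x, g i⟫ ≤ f i)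
    (hmin : ∀ y : H, (∀ i ∈ I₁, ⟪y, g i⟫ = f i) → (∀ i ∈ I₂, ⟪y, g i⟫ ≤ f i) →
      ‖x - v‖ ≤ ‖y - v‖) :
    ∃ S : Finset ι, B ⊆ S ∧ (∀ i ∈ S, i ∉ B → i ∈ I₂) ∧ (∀ i ∈ S, ⟪x, g i⟫ = f i) ∧
      LinearIndepOn ℝ g (S : Set ι) ∧ ∃ l : ι → ℝ, (∀ i ∈ S, i ∉ B → 0 ≤ l i) ∧
        ∑ i ∈ S, l i • g i = v - x := by
  classical
  set S := B ∪ I₂.filter (fun i => ⟪x, g i⟫ = f i) with hSdef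
  have hBS : B ⊆ S := Finset.subset_union_left
  have hSact : ∀ i ∈ S, ⟪x, g i⟫ = f i := by
    intro i hi
    rcases Finset.mem_union.1 hi with h | h
    · exact hx1 i (hBI h)
    · exact (Finset.mem_filter.1 h).2
  have hSI : ∀ i ∈ S, i ∉ B → i ∈ I₂ := by
    intro i hi hiB
    rcases Finset.mem_union.1 hi with h | h
    · exact absurd h hiB
    · exact (Finset.mem_filter.1 h).1
  set K := {w : H | ∃ l : ι → ℝ, (∀ i ∈ S, i ∉ B → 0 ≤ l i) ∧ ∑ i ∈ S, l i • g i = w} with hK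
  suffices hmem : v - x ∈ K by
    obtain ⟨l, hl, hw⟩ := hmem
    obtain ⟨S', h1, h2, h3, m, hm, hs⟩ := aux_carath g B hB S hBS l hl
    exact ⟨S', h2, fun i hi => hSI i (h1 hi), fun i hi => hSact i (h1 hi), h3, m, hm, hs.trans hw⟩
  have hKc : IsClosed K := aux_closed g B S hB hBS
  have hadd : ∀ a ∈ K, ∀ b ∈ K, a + b ∈ K := by
    rintro a ⟨l, hl, rfl⟩ b ⟨m, hm, rfl⟩
    refine ⟨l + m, fun i hi hiB => add_nonneg (hl i hi hiB) (hm i hi hiB), ?_⟩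
    simp [add_smul, Finset.sum_add_distrib]
  have hsmul : ∀ t : ℝ, 0 ≤ t → ∀ a ∈ K, t • a ∈ K := by
    rintro t ht a ⟨l, hl, rfl⟩
    refine ⟨fun i => t * l i, fun i hi hiB => mul_nonneg ht (hl i hi hiB), ?_⟩
    simp [mul_smul, Finset.smul_sum]
  have hKconv : Convex ℝ K := by
    intro a ha b hb s t hs ht _
    exact hadd _ (hsmul s hs a ha) _ (hsmul t ht b hb)
  have hK0 : (0 : H) ∈ K := ⟨0, by simp, by simp⟩
  have hgK : ∀ i ∈ S, g i ∈ K := by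
    intro i hi
    refine ⟨Pi.single i 1, ?_, ?_⟩
    · intro j _ _
      by_cases h : j = i
      · subst h; simp
      · simp [h]
    · simp [Pi.single_apply, hi]
  have hngK : ∀ i ∈ B, - g i ∈ K := by
    intro i hi
    refine ⟨Pi.single i (-1), ?_, ?_⟩
    · intro j _ hj
      have h : j ≠ i := fun h => hj (h ▸ hi)
      simp [h]
    · simp [Pi.single_apply, hBS hi]
  obtain ⟨k, hkK, hk⟩ := exists_norm_eq_iInf_of_complete_convex ⟨0, hK0⟩ hKc.isComplete hKconv (v - x)
  rw [norm_eq_iInf_iff_real_inner_le_zero hKconv hkK] at hk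
  set r := v - x - k with hr
  have hrg : ∀ i ∈ S, ⟪r, g i⟫ ≤ 0 := by
    intro i hi
    have := hk (k + g i) (hadd _ hkK _ (hgK i hi))
    simpa using this
  have hrB : ∀ i ∈ B, ⟪r, g i⟫ = 0 := by
    intro i hi
    have := hk (k + - g i) (hadd _ hkK _ (hngK i hi))
    rw [add_sub_cancel_left, inner_neg_right] at this
    linarith [hrg i (hBS hi)]
  have hrI : ∀ i ∈ I₁, ⟪r, g i⟫ = 0 := by
    intro i hi
    have hle : Submodule.span ℝ (g '' (B : Set ι)) ≤ LinearMap.ker (innerₗ H r) := by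
      rw [Submodule.span_le]
      rintro _ ⟨j, hj, rfl⟩
      simpa using hrB j hj
    simpa using hle (hspan i hi)
  have hrk : 0 ≤ ⟪r, k⟫ := by
    have := hk 0 hK0
    rw [zero_sub, inner_neg_right] at this
    linarith
  have hrw : ‖r‖ ^ 2 ≤ ⟪r, v - x⟫ := by
    have : v - x = r + k := by rw [hr]; abel
    rw [this, inner_add_right, real_inner_self_eq_norm_sq]
    linarith
  have hev : ∀ᶠ t : ℝ in nhdsWithin 0 (Set.Ioi 0), ∀ i ∈ I₂, ⟪x + t • r, g i⟫ ≤ f i := by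
    rw [Filter.eventually_all_finset]
    intro i hi
    rcases (hx2 i hi).lt_or_eq with h | h
    · have hc : Filter.Tendsto (fun t : ℝ => ⟪x + t • r, g i⟫) (nhdsWithin 0 (Set.Ioi 0))
          (nhds ⟪x, g i⟫) := by
        have : Continuous (fun t : ℝ => ⟪x + t • r, g i⟫) := by fun_prop
        have h0 := this.tendsto 0
        simp only [zero_smul, add_zero] at h0
        exact h0.mono_left nhdsWithin_le_nhds
      exact (hc.eventually (gt_mem_nhds h)).mono fun t ht => ht.le
    · filter_upwards [self_mem_nhdsWithin] with t ht
      have : i ∈ S := Finset.mem_union_right _ (Finset.mem_filter.2 ⟨hi, h⟩)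
      rw [inner_add_left, inner_smul_left, h]
      have h2 := mul_nonpos_of_nonneg_of_nonpos (le_of_lt ht) (hrg i this)
      simpa using h2
  have hev1 : ∀ᶠ t : ℝ in nhdsWithin 0 (Set.Ioi 0), t < 1 :=
    (gt_mem_nhds one_pos).filter_mono nhdsWithin_le_nhds
  obtain ⟨t, ht2, ht1, ht0⟩ := (hev.and (hev1.and self_mem_nhdsWithin)).exists
  have ht0 : 0 < t := ht0
  have hm := hmin (x + t • r) (by
    intro i hi
    rw [inner_add_left, inner_smul_left, hrI i hi, hx1 i hi]; simp) ht2
  have h3 : ‖x + t • r - v‖ ^ 2 = ‖x - v‖ ^ 2 - 2 * t * ⟪r, v - x⟫ + t ^ 2 * ‖r‖ ^ 2 := by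
    have : x + t • r - v = t • r - (v - x) := by abel
    rw [this, norm_sub_sq_real, norm_smul, inner_smul_left, norm_sub_rev v x, mul_pow]
    simp
    ring
  have h4 : ‖x - v‖ ^ 2 ≤ ‖x + t • r - v‖ ^ 2 := by gcongr
  have h5 : ‖r‖ ^ 2 ≤ 0 := by
    rw [h3] at h4
    have h6 : t * (2 * ⟪r, v - x⟫) ≤ t * (t * ‖r‖ ^ 2) := by nlinarith
    have h7 := le_of_mul_le_mul_left h6 ht0
    nlinarith [sq_nonneg ‖r‖]
  have h6 : r = 0 := by
    have : ‖r‖ = 0 := by nlinarith [norm_nonneg r]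
    simpa using this
  have : v - x = k := by rw [hr] at h6; exact sub_eq_zero.1 h6
  rw [this]; exact hkK

lemma aux_ineq {ι H : Type*} [NormedAddCommGroup H] [InnerProductSpace ℝ H]
    (g g' : ι → H) (f f' : ι → ℝ) (I₁ I₂ B S : Finset ι) (hBI : B ⊆ I₁)
    (hSI : ∀ i ∈ S, i ∉ B → i ∈ I₂) (x x' : H)
    (hact : ∀ i ∈ S, ⟪x, g i⟫ = f i) (l : ι → ℝ) (hl : ∀ i ∈ S, i ∉ B → 0 ≤ l i)
    (hx1 : ∀ i ∈ I₁, ⟪x', g' i⟫ = f' i) (hx2 : ∀ i ∈ I₂, ⟪x', g' i⟫ ≤ f' i)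
    (R δ : ℝ) (hδ : 0 ≤ δ) (hR : ‖x'‖ ≤ R) (hg : ∀ i, ‖g i - g' i‖ ≤ δ)
    (hf : ∀ i, |f i - f' i| ≤ δ) :
    ⟪∑ i ∈ S, l i • g i, x' - x⟫ ≤ (∑ i ∈ S, |l i|) * ((R + 1) * δ) := by
  rw [sum_inner, Finset.sum_mul]
  apply Finset.sum_le_sum
  intro i hi
  rw [inner_smul_left]
  have e : ⟪g i, x' - x⟫ = (⟪x', g' i⟫ - f' i) + (⟪g i - g' i, x'⟫ + (f' i - f i)) := by
    rw [inner_sub_right, inner_sub_left, ← hact i hi, real_inner_comm x (g i),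
      real_inner_comm x' (g' i)]
    ring
  have h1 : |⟪g i - g' i, x'⟫ + (f' i - f i)| ≤ (R + 1) * δ := by
    have h2 := abs_real_inner_le_norm (g i - g' i) x'
    have h3 : ‖g i - g' i‖ * ‖x'‖ ≤ δ * R := by
      gcongr
      exact hg i
    have h4 := abs_add_le ⟪g i - g' i, x'⟫ (f' i - f i)
    have h5 := hf i
    rw [abs_sub_comm] at h5
    linarith
  have h2 : l i * (⟪g i - g' i, x'⟫ + (f' i - f i)) ≤ |l i| * ((R + 1) * δ) := by
    refine (le_abs_self _).trans ?_
    rw [abs_mul]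
    gcongr
  have h3 : l i * (⟪x', g' i⟫ - f' i) ≤ 0 := by
    by_cases hiB : i ∈ B
    · rw [hx1 i (hBI hiB)]; simp
    · exact mul_nonpos_of_nonneg_of_nonpos (hl i hi hiB) (by linarith [hx2 i (hSI i hi hiB)])
  rw [e, mul_add]
  simp only [conj_trivial]
  linarith

lemma aux_bound_ev {ι H G : Type*} [NormedAddCommGroup H] [NormedSpace ℝ H]
    (g : ι → G → H) (gb : ι → H) (F : Filter G)
    (hg : ∀ i, Filter.Tendsto (g i) F (nhds (gb i)))
    (S : Finset ι) (hS : LinearIndepOn ℝ gb (S : Set ι)) :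
    ∃ c ≥ (0 : ℝ), ∀ᶠ p in F, ∀ l : ι → ℝ,
      ∑ i ∈ S, |l i| ≤ c * ‖∑ i ∈ S, l i • g i p‖ := by
  obtain ⟨c, hc, h⟩ := aux_bound gb S hS
  refine ⟨2 / c, by positivity, ?_⟩
  have hev : ∀ᶠ p in F, ∀ i ∈ S, ‖g i p - gb i‖ < c / 2 := by
    rw [Filter.eventually_all_finset]
    intro i _
    have := (hg i).eventually (Metric.ball_mem_nhds (gb i) (half_pos hc))
    filter_upwards [this] with p hp
    simpa [dist_eq_norm] using hp
  filter_upwards [hev] with p hp l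
  have h1 := h l
  have h2 : ‖∑ i ∈ S, l i • gb i‖ ≤ ‖∑ i ∈ S, l i • g i p‖ + c / 2 * ∑ i ∈ S, |l i| := by
    have e : ∑ i ∈ S, l i • gb i = ∑ i ∈ S, l i • g i p - ∑ i ∈ S, l i • (g i p - gb i) := by
      rw [← Finset.sum_sub_distrib]
      apply Finset.sum_congr rfl
      intro i _
      rw [smul_sub]; abel
    rw [e]
    refine (norm_sub_le _ _).trans ?_
    gcongr
    refine (norm_sum_le _ _).trans ?_
    rw [Finset.mul_sum]
    apply Finset.sum_le_sum
    intro i hi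
    rw [norm_smul, Real.norm_eq_abs, mul_comm]
    gcongr
    exact (hp i hi).le
  rw [div_mul_eq_mul_div, le_div_iff₀ hc]
  linarith

lemma aux_card {ι H : Type*} [AddCommGroup H] [Module ℝ H] (g : ι → H) (S : Finset ι) :
    LinearIndepOn ℝ g (S : Set ι) ↔
      S.card ≤ Module.finrank ℝ (Submodule.span ℝ (g '' (S : Set ι))) := by
  have := linearIndependent_iff_card_le_finrank_span (R := ℝ) (b := fun i : S => g i)
  have e : Set.range (fun i : S => g i) = g '' (S : Set ι) := by
    ext; simp
  rw [e, Fintype.card_coe] at this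
  exact this

lemma aux_final {H : Type*} [NormedAddCommGroup H] [InnerProductSpace ℝ H]
    (v₁ v₂ x₁ x₂ : H) (N δ : ℝ) (hN : 0 ≤ N) (hδ : 0 ≤ δ)
    (h1 : ⟪v₁ - x₁, x₂ - x₁⟫ ≤ N * δ) (h2 : ⟪v₂ - x₂, x₁ - x₂⟫ ≤ N * δ) :
    ‖(v₁ - v₂) - (2 : ℝ) • (x₁ - x₂)‖ ≤ ‖v₁ - v₂‖ + Real.sqrt (8 * N) * Real.sqrt δ := by
  have e : ‖(v₁ - v₂) - (2 : ℝ) • (x₁ - x₂)‖ ^ 2 = ‖v₁ - v₂‖ ^ 2 +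
      4 * (⟪v₁ - x₁, x₂ - x₁⟫ + ⟪v₂ - x₂, x₁ - x₂⟫) := by
    simp only [← real_inner_self_eq_norm_sq, inner_sub_left, inner_sub_right, inner_smul_left,
      inner_smul_right, conj_trivial]
    rw [real_inner_comm x₁ v₁, real_inner_comm x₁ v₂, real_inner_comm x₂ v₁,
      real_inner_comm x₂ v₂, real_inner_comm x₁ x₂]
    ring
  refine (sq_le_sq₀ (norm_nonneg _) (by positivity)).1 ?_
  · rw [e]
    have s1 := Real.sq_sqrt (by positivity : 0 ≤ 8 * N)
    have s2 := Real.sq_sqrt hδ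
    have s3 : 0 ≤ 2 * ‖v₁ - v₂‖ * (Real.sqrt (8 * N) * Real.sqrt δ) := by positivity
    have : (‖v₁ - v₂‖ + Real.sqrt (8 * N) * Real.sqrt δ) ^ 2 = ‖v₁ - v₂‖ ^ 2 +
      2 * ‖v₁ - v₂‖ * (Real.sqrt (8 * N) * Real.sqrt δ) + (8 * N) * δ := by
      have s4 : Real.sqrt (8 * N) ^ 2 * Real.sqrt δ ^ 2 = (8 * N) * δ := by rw [s1, s2]
      rw [← s4]
      ring
    rw [this]
    linarith

/-- Under RCRCQ and the lower Kuratowski limit condition, the projection onto the moving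
polyhedral set satisfies a Hölder-1/2 stability estimate. -/
theorem stmt_13 {H G : Type*} [NormedAddCommGroup H] [InnerProductSpace ℝ H]
    [CompleteSpace H] [NormedAddCommGroup G] [NormedSpace ℝ G]
    (D : Set G) {ι : Type*} [Fintype ι] (I₁ I₂ : Finset ι)
    (f : ι → G → ℝ) (g : ι → G → H)
    (C : G → Set H)
    (hCdef : ∀ p, C p = {x : H | (∀ i ∈ I₁, ⟪x, g i p⟫ = f i p) ∧
      (∀ i ∈ I₂, ⟪x, g i p⟫ ≤ f i p)})
    (pbar : G) (hpbar : pbar ∈ D) (vbar xbar : H) (hxbarC : xbar ∈ C pbar)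
    (hLip : ∀ i, ∃ K : NNReal, ∃ t ∈ nhdsWithin pbar D,
      LipschitzOnWith K (f i) t ∧ LipschitzOnWith K (g i) t)
    -- RCRCQ at (pbar, xbar)
    (hRCRCQ : ∃ U₀ ∈ nhdsWithin pbar D, ∀ J : Finset ι, I₁ ⊆ J →
      (∀ i ∈ J, (i ∈ I₁ ∨ i ∈ I₂) ∧ ⟪xbar, g i pbar⟫ = f i pbar) →
      ∀ p ∈ U₀,
        Module.finrank ℝ (Submodule.span ℝ ((fun i => g i p) '' (J : Set ι))) =
        Module.finrank ℝ (Submodule.span ℝ ((fun i => g i pbar) '' (J : Set ι))))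
    -- xbar belongs to the lower Kuratowski limit of C(p)
    (hliminf : ∀ V ∈ nhds xbar, ∃ U ∈ nhds pbar, ∀ p ∈ U ∩ D, (C p ∩ V).Nonempty)
    -- P(v,p) is the metric projection of v onto C(p)
    (P : H → G → H)
    (hP : ∀ v : H, ∀ p ∈ D, (C p).Nonempty →
      P v p ∈ C p ∧ ∀ y ∈ C p, ‖P v p - v‖ ≤ ‖y - v‖)
    (hxbarP : xbar = P vbar pbar) :
    ∃ ℓ₀ > (0 : ℝ), ∃ W ∈ nhds vbar, ∃ U ∈ nhds pbar,
      ∀ v₁ ∈ W, ∀ v₂ ∈ W, ∀ p₁ ∈ U ∩ D, ∀ p₂ ∈ U ∩ D,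
        ‖(v₁ - v₂) - (2 : ℝ) • (P v₁ p₁ - P v₂ p₂)‖ ≤
          ‖v₁ - v₂‖ + ℓ₀ * Real.sqrt ‖p₁ - p₂‖ := by
  classical
  set F := nhdsWithin pbar D with hF
  have hC : ∀ p x, x ∈ C p ↔ (∀ i ∈ I₁, ⟪x, g i p⟫ = f i p) ∧ (∀ i ∈ I₂, ⟪x, g i p⟫ ≤ f i p) := by
    intro p x
    rw [hCdef p]; rfl
  have hxb := (hC _ _).1 hxbarC
  -- common Lipschitz data
  obtain ⟨K, hK0, T, hTF, hTg, hTf⟩ : ∃ K : ℝ, 0 ≤ K ∧ ∃ T ∈ F,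
      (∀ p ∈ T, ∀ p' ∈ T, ∀ i, ‖g i p - g i p'‖ ≤ K * ‖p - p'‖) ∧
      (∀ p ∈ T, ∀ p' ∈ T, ∀ i, |f i p - f i p'| ≤ K * ‖p - p'‖) := by
    choose k t ht hkf hkg using hLip
    have hle : ∀ i, (k i : ℝ) ≤ ∑ j, (k j : ℝ) := fun i =>
      Finset.single_le_sum (f := fun j => (k j : ℝ)) (fun j _ => (k j).2) (Finset.mem_univ i)
    refine ⟨∑ i, (k i : ℝ), Finset.sum_nonneg fun i _ => (k i).2, ⋂ i, t i,
      Filter.iInter_mem.2 ht, ?_, ?_⟩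
    · intro p hp p' hp' i
      rw [Set.mem_iInter] at hp hp'
      have := (hkg i).dist_le_mul p (hp i) p' (hp' i)
      rw [dist_eq_norm, dist_eq_norm] at this
      exact this.trans (mul_le_mul_of_nonneg_right (hle i) (norm_nonneg _))
    · intro p hp p' hp' i
      rw [Set.mem_iInter] at hp hp'
      have := (hkf i).dist_le_mul p (hp i) p' (hp' i)
      rw [dist_eq_norm, dist_eq_norm, Real.norm_eq_abs] at this
      exact this.trans (mul_le_mul_of_nonneg_right (hle i) (norm_nonneg _))
  have hpT : pbar ∈ T := mem_of_mem_nhdsWithin hpbar hTF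
  have hDF : D ∈ F := self_mem_nhdsWithin
  have hsmall : Filter.Tendsto (fun p => K * ‖p - pbar‖) F (nhds 0) := by
    have : Continuous (fun p : G => K * ‖p - pbar‖) := by fun_prop
    have h := this.tendsto pbar
    simp only [sub_self, norm_zero, mul_zero] at h
    exact h.mono_left nhdsWithin_le_nhds
  have hgt : ∀ i, Filter.Tendsto (g i) F (nhds (g i pbar)) := by
    intro i
    rw [tendsto_iff_norm_sub_tendsto_zero]
    refine squeeze_zero' (Filter.Eventually.of_forall fun _ => norm_nonneg _) ?_ hsmall
    filter_upwards [hTF] with p hp using hTg p hp pbar hpT i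
  have hft : ∀ i, Filter.Tendsto (f i) F (nhds (f i pbar)) := by
    intro i
    rw [tendsto_iff_norm_sub_tendsto_zero]
    refine squeeze_zero' (Filter.Eventually.of_forall fun _ => norm_nonneg _) ?_ hsmall
    filter_upwards [hTF] with p hp using hTf p hp pbar hpT i
  obtain ⟨U₀, hU₀, hrank⟩ := hRCRCQ
  -- basis of the equality constraints
  obtain ⟨B, hBI, hBind, hBspan⟩ : ∃ B : Finset ι, B ⊆ I₁ ∧
      LinearIndepOn ℝ (fun i => g i pbar) (B : Set ι) ∧
      ∀ i ∈ I₁, g i pbar ∈ Submodule.span ℝ ((fun i => g i pbar) '' (B : Set ι)) := by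
    obtain ⟨b, hb, -, hsp, hind⟩ := exists_linearIndepOn_extension (K := ℝ)
      (v := fun i => g i pbar) (linearIndepOn_empty ℝ _) (Set.empty_subset (I₁ : Set ι))
    have hbfin : b.Finite := I₁.finite_toSet.subset hb
    refine ⟨hbfin.toFinset, ?_, ?_, ?_⟩
    · simpa using hb
    · simpa using hind
    · intro i hi
      simpa using hsp ⟨i, hi, rfl⟩
  -- multiplier bounds
  have hbd : ∀ S : Finset ι, ∃ c ≥ (0 : ℝ), LinearIndepOn ℝ (fun i => g i pbar) (S : Set ι) →
      ∀ᶠ p in F, ∀ l : ι → ℝ, ∑ i ∈ S, |l i| ≤ c * ‖∑ i ∈ S, l i • g i p‖ := by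
    intro S
    by_cases hS : LinearIndepOn ℝ (fun i => g i pbar) (S : Set ι)
    · obtain ⟨c, hc, h⟩ := aux_bound_ev g (fun i => g i pbar) F hgt S hS
      exact ⟨c, hc, fun _ => h⟩
    · exact ⟨0, le_rfl, fun h => absurd h hS⟩
  choose c hc0 hcb using hbd
  have hcev : ∀ᶠ p in F, ∀ S : Finset ι, LinearIndepOn ℝ (fun i => g i pbar) (S : Set ι) →
      ∀ l : ι → ℝ, ∑ i ∈ S, |l i| ≤ (∑ S, c S) * ‖∑ i ∈ S, l i • g i p‖ := by
    rw [Filter.eventually_all]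
    intro S
    by_cases hS : LinearIndepOn ℝ (fun i => g i pbar) (S : Set ι)
    · filter_upwards [hcb S hS] with p hp _ l
      refine (hp l).trans ?_
      gcongr
      exact Finset.single_le_sum (f := c) (fun j _ => hc0 j) (Finset.mem_univ S)
    · exact Filter.Eventually.of_forall fun p h => absurd h hS
  have hI₁act : ∀ i ∈ I₁, (i ∈ I₁ ∨ i ∈ I₂) ∧ ⟪xbar, g i pbar⟫ = f i pbar :=
    fun i hi => ⟨Or.inl hi, hxb.1 i hi⟩
  have hBp : ∀ᶠ p in F, LinearIndepOn ℝ (fun i => g i p) (B : Set ι) ∧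
      ∀ i ∈ I₁, g i p ∈ Submodule.span ℝ ((fun i => g i p) '' (B : Set ι)) := by
    filter_upwards [hcev, hU₀] with p hp hpU
    have hind : LinearIndepOn ℝ (fun i => g i p) (B : Set ι) := by
      rw [linearIndepOn_finset_iff]
      intro l hl i hi
      have h1 := hp B hBind l
      rw [hl, norm_zero, mul_zero] at h1
      have h2 := Finset.single_le_sum (f := fun i => |l i|) (fun j _ => abs_nonneg _) hi
      exact abs_nonpos_iff.1 (h2.trans h1)
    refine ⟨hind, ?_⟩
    have hr := hrank I₁ subset_rfl hI₁act p hpU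
    have hfd : FiniteDimensional ℝ (Submodule.span ℝ ((fun i => g i p) '' (I₁ : Set ι))) :=
      FiniteDimensional.span_of_finite ℝ (I₁.finite_toSet.image _)
    have hfdB : FiniteDimensional ℝ (Submodule.span ℝ ((fun i => g i pbar) '' (B : Set ι))) :=
      FiniteDimensional.span_of_finite ℝ (B.finite_toSet.image _)
    have hle : Submodule.span ℝ ((fun i => g i p) '' (B : Set ι)) ≤
        Submodule.span ℝ ((fun i => g i p) '' (I₁ : Set ι)) :=
      Submodule.span_mono (Set.image_mono (by exact_mod_cast hBI))
    have h1 : Module.finrank ℝ (Submodule.span ℝ ((fun i => g i pbar) '' (I₁ : Set ι))) ≤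
        B.card := by
      have h2 : Submodule.span ℝ ((fun i => g i pbar) '' (I₁ : Set ι)) ≤
          Submodule.span ℝ ((fun i => g i pbar) '' (B : Set ι)) := by
        rw [Submodule.span_le]
        rintro _ ⟨i, hi, rfl⟩
        exact hBspan i hi
      refine (Submodule.finrank_mono h2).trans ?_
      have h3 := finrank_span_finset_le_card (R := ℝ) (B.image (fun i => g i pbar))
      rw [Set.finrank, Finset.coe_image] at h3
      exact h3.trans Finset.card_image_le
    have heq := Submodule.eq_of_le_of_finrank_le hle (by
      rw [hr]; exact h1.trans ((aux_card _ _).1 hind))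
    intro i hi
    rw [heq]
    exact Submodule.subset_span ⟨i, hi, rfl⟩
  -- KKT at the reference point
  have hCbar : (C pbar).Nonempty := ⟨xbar, hxbarC⟩
  have hPbar := hP vbar pbar hpbar hCbar
  rw [← hxbarP] at hPbar
  obtain ⟨S₀, hBS₀, hS₀I, hS₀act, -, l₀, hl₀, hl₀sum⟩ := aux_kkt (fun i => g i pbar)
    (fun i => f i pbar) I₁ I₂ B hBind hBI hBspan vbar xbar hxb.1 hxb.2
    (fun y h1 h2 => hPbar.2 y ((hC _ _).2 ⟨h1, h2⟩))
  -- convergence of the projections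
  have hPlim : ∀ ε > (0 : ℝ), ∀ᶠ z in nhds vbar ×ˢ F, P z.1 z.2 ∈ C z.2 ∧
      (∀ y ∈ C z.2, ‖P z.1 z.2 - z.1‖ ≤ ‖y - z.1‖) ∧ ‖P z.1 z.2 - xbar‖ < ε := by
    intro ε hε
    set d := ‖xbar - vbar‖ with hd
    set R₀ := ‖vbar‖ + d + 3 with hR₀
    set L := ∑ i ∈ S₀, |l₀ i| with hL
    have hL0 : 0 ≤ L := Finset.sum_nonneg fun _ _ => abs_nonneg _
    have hd0 : 0 ≤ d := norm_nonneg _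
    have hv0 := norm_nonneg vbar
    set N := 6 * d + 9 + 2 * (L * (R₀ + 1)) with hN
    have hN0 : 0 < N := by positivity
    set δ := min 1 (ε ^ 2 / (2 * N)) with hδ
    have hδ0 : 0 < δ := by positivity
    have hδ1 : δ ≤ 1 := min_le_left _ _
    have hδN : δ * N < ε ^ 2 := by
      have h1 : δ ≤ ε ^ 2 / (2 * N) := min_le_right _ _
      rw [le_div_iff₀ (by positivity)] at h1
      nlinarith
    obtain ⟨U₁, hU₁, hU₁C⟩ := hliminf (Metric.ball xbar δ) (Metric.ball_mem_nhds _ hδ0)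
    have hv : ∀ᶠ v in nhds vbar, v ∈ Metric.ball vbar δ := Metric.ball_mem_nhds _ hδ0
    have hpe : ∀ᶠ p in F, p ∈ T ∧ p ∈ D ∧ p ∈ U₁ ∧ K * ‖p - pbar‖ < δ :=
      Filter.Eventually.and hTF (Filter.Eventually.and hDF
        (Filter.Eventually.and (mem_nhdsWithin_of_mem_nhds hU₁)
          (hsmall.eventually (gt_mem_nhds hδ0))))
    filter_upwards [hv.prod_mk hpe] with z hz
    obtain ⟨v, p⟩ := z
    obtain ⟨hvδ, hpT', hpD, hpU, hpδ⟩ := hz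
    simp only at hvδ hpT' hpD hpU hpδ ⊢
    obtain ⟨y, hyC, hyδ⟩ := hU₁C p ⟨hpU, hpD⟩
    obtain ⟨hPC, hPm⟩ := hP v p hpD ⟨y, hyC⟩
    refine ⟨hPC, hPm, ?_⟩
    rw [Metric.mem_ball, dist_eq_norm] at hvδ hyδ
    set x := P v p with hx
    have h1 : ‖x - vbar‖ ≤ d + 3 * δ := by
      have a1 : ‖x - vbar‖ ≤ ‖x - v‖ + ‖v - vbar‖ := norm_sub_le_norm_sub_add_norm_sub _ _ _
      have a2 := hPm y hyC
      have a3 : ‖y - v‖ ≤ ‖y - xbar‖ + ‖xbar - v‖ := norm_sub_le_norm_sub_add_norm_sub _ _ _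
      have a4 : ‖xbar - v‖ ≤ ‖xbar - vbar‖ + ‖vbar - v‖ := norm_sub_le_norm_sub_add_norm_sub _ _ _
      rw [norm_sub_rev vbar v] at a4
      linarith
    have h2 : ‖x‖ ≤ R₀ := by
      have a1 : ‖x‖ ≤ ‖x - vbar‖ + ‖vbar‖ := by
        simpa using norm_add_le (x - vbar) vbar
      linarith
    have hxC := (hC _ _).1 hPC
    have h3 := aux_ineq (fun i => g i pbar) (fun i => g i p) (fun i => f i pbar) (fun i => f i p)
      I₁ I₂ B S₀ hBI hS₀I xbar x hS₀act l₀ hl₀ hxC.1 hxC.2 R₀ δ hδ0.le h2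
      (fun i => by
        have := hTg pbar hpT p hpT' i
        rw [norm_sub_rev pbar p] at this
        exact this.trans hpδ.le)
      (fun i => by
        have := hTf pbar hpT p hpT' i
        rw [norm_sub_rev pbar p] at this
        exact this.trans hpδ.le)
    rw [hl₀sum] at h3
    have h4 : ‖x - xbar‖ ^ 2 = ‖x - vbar‖ ^ 2 - d ^ 2 + 2 * ⟪vbar - xbar, x - xbar⟫ := by
      have e : x - vbar = (x - xbar) - (vbar - xbar) := by abel
      have e2 := norm_sub_sq_real (x - xbar) (vbar - xbar)
      rw [← e, real_inner_comm, norm_sub_rev vbar xbar, ← hd] at e2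
      linarith
    have h5 : ‖x - vbar‖ ^ 2 ≤ (d + 3 * δ) ^ 2 := by gcongr
    have h6 : ‖x - xbar‖ ^ 2 < ε ^ 2 := by
      refine lt_of_le_of_lt ?_ hδN
      rw [h4, hN]
      nlinarith
    exact lt_of_pow_lt_pow_left₀ 2 hε.le h6
  have hPtend : Filter.Tendsto (fun z : H × G => P z.1 z.2) (nhds vbar ×ˢ F) (nhds xbar) := by
    rw [Metric.tendsto_nhds]
    intro ε hε
    filter_upwards [hPlim ε hε] with z hz
    rw [dist_eq_norm]; exact hz.2.2
  -- inactive constraints remain inactive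
  have hinact : ∀ᶠ z in nhds vbar ×ˢ F, ∀ i, ⟪xbar, g i pbar⟫ < f i pbar →
      ⟪P z.1 z.2, g i z.2⟫ < f i z.2 := by
    rw [Filter.eventually_all]
    intro i
    by_cases hi : ⟪xbar, g i pbar⟫ < f i pbar
    · have h1 : Filter.Tendsto (fun z : H × G => ⟪P z.1 z.2, g i z.2⟫) (nhds vbar ×ˢ F)
          (nhds ⟪xbar, g i pbar⟫) := hPtend.inner ((hgt i).comp Filter.tendsto_snd)
      have h2 : Filter.Tendsto (fun z : H × G => f i z.2) (nhds vbar ×ˢ F)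
          (nhds (f i pbar)) := (hft i).comp Filter.tendsto_snd
      filter_upwards [h1.eventually_lt h2 hi] with z hz _ using hz
    · exact Filter.Eventually.of_forall fun z h => absurd h hi
  set R := ‖xbar‖ + 1 with hRdef
  set M := (∑ S, c S) * (‖vbar‖ + 1 + R) with hM
  have hcs : 0 ≤ ∑ S, c S := Finset.sum_nonneg fun S _ => hc0 S
  have hM0 : 0 ≤ M := by positivity
  have hall : ∀ᶠ z in nhds vbar ×ˢ F, z.2 ∈ T ∧ P z.1 z.2 ∈ C z.2 ∧ ‖P z.1 z.2‖ ≤ R ∧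
      ∃ S : Finset ι, (∀ i ∈ S, i ∉ B → i ∈ I₂) ∧ (∀ i ∈ S, ⟪P z.1 z.2, g i z.2⟫ = f i z.2) ∧
      ∃ l : ι → ℝ, (∀ i ∈ S, i ∉ B → 0 ≤ l i) ∧
        ∑ i ∈ S, l i • g i z.2 = z.1 - P z.1 z.2 ∧ ∑ i ∈ S, |l i| ≤ M := by
    have hv : ∀ᶠ v in nhds vbar, v ∈ Metric.ball vbar 1 := Metric.ball_mem_nhds _ one_pos
    have hpe : ∀ᶠ p in F, p ∈ T ∧ p ∈ U₀ ∧ 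
        (LinearIndepOn ℝ (fun i => g i p) (B : Set ι) ∧
          ∀ i ∈ I₁, g i p ∈ Submodule.span ℝ ((fun i => g i p) '' (B : Set ι))) ∧
        (∀ S : Finset ι, LinearIndepOn ℝ (fun i => g i pbar) (S : Set ι) →
          ∀ l : ι → ℝ, ∑ i ∈ S, |l i| ≤ (∑ S, c S) * ‖∑ i ∈ S, l i • g i p‖) :=
      Filter.Eventually.and hTF (Filter.Eventually.and hU₀ (hBp.and hcev))
    filter_upwards [hv.prod_mk hpe, hPlim 1 one_pos, hinact] with z hz hPz hin
    obtain ⟨v, p⟩ := z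
    obtain ⟨hv1, hpT', hpU, ⟨hBi, hBs⟩, hcp⟩ := hz
    simp only at hv1 hpT' hpU hBi hBs hcp hPz hin ⊢
    obtain ⟨hPC, hPm, hPx⟩ := hPz
    rw [Metric.mem_ball, dist_eq_norm] at hv1
    set x := P v p with hx
    have hxR : ‖x‖ ≤ R := by
      have a1 : ‖x‖ ≤ ‖x - xbar‖ + ‖xbar‖ := by
        simpa using norm_add_le (x - xbar) xbar
      linarith
    have hvR : ‖v‖ ≤ ‖vbar‖ + 1 := by
      have a1 : ‖v‖ ≤ ‖v - vbar‖ + ‖vbar‖ := by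
        simpa using norm_add_le (v - vbar) vbar
      linarith
    have hxC := (hC _ _).1 hPC
    obtain ⟨S, hBS, hSI, hSact, hSind, l, hl, hlsum⟩ := aux_kkt (fun i => g i p)
      (fun i => f i p) I₁ I₂ B hBi hBI hBs v x hxC.1 hxC.2
      (fun y h1 h2 => hPm y ((hC _ _).2 ⟨h1, h2⟩))
    refine ⟨hpT', hPC, hxR, S, hSI, hSact, l, hl, hlsum, ?_⟩
    have hSbar : LinearIndepOn ℝ (fun i => g i pbar) (S : Set ι) := by
      rw [aux_card]
      have hr := hrank (I₁ ∪ S) Finset.subset_union_left (by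
        intro i hi
        by_cases hi1 : i ∈ I₁
        · exact hI₁act i hi1
        · have hiS : i ∈ S := (Finset.mem_union.1 hi).resolve_left hi1
          have hi2 : i ∈ I₂ := hSI i hiS fun h => hi1 (hBI h)
          refine ⟨Or.inr hi2, ?_⟩
          by_contra hne
          have := hin i (lt_of_le_of_ne (hxb.2 i hi2) hne)
          exact this.ne (hSact i hiS)) p hpU
      have hfd : FiniteDimensional ℝ
          (Submodule.span ℝ ((fun i => g i p) '' ((I₁ ∪ S : Finset ι) : Set ι))) :=
        FiniteDimensional.span_of_finite ℝ ((I₁ ∪ S).finite_toSet.image _)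
      have hfdS : FiniteDimensional ℝ (Submodule.span ℝ ((fun i => g i pbar) '' (S : Set ι))) :=
        FiniteDimensional.span_of_finite ℝ (S.finite_toSet.image _)
      have a1 : S.card ≤ Module.finrank ℝ
          (Submodule.span ℝ ((fun i => g i p) '' ((I₁ ∪ S : Finset ι) : Set ι))) :=
        ((aux_card _ _).1 hSind).trans (Submodule.finrank_mono (Submodule.span_mono
          (Set.image_mono (by exact_mod_cast Finset.subset_union_right))))
      rw [hr] at a1
      refine a1.trans (Submodule.finrank_mono ?_)
      rw [Submodule.span_le]
      rintro _ ⟨i, hi, rfl⟩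
      rcases Finset.mem_union.1 (Finset.mem_coe.1 hi) with h | h
      · exact Submodule.span_mono (Set.image_mono (by exact_mod_cast hBS)) (hBspan i h)
      · exact Submodule.subset_span ⟨i, h, rfl⟩
    have hb := hcp S hSbar l
    rw [hlsum] at hb
    refine hb.trans ?_
    rw [hM]
    gcongr
    exact (norm_sub_le _ _).trans (by linarith)
  obtain ⟨W, hW, U', hU', hWU⟩ := Filter.mem_prod_iff.1 hall
  obtain ⟨U, hU, hUD⟩ := mem_nhdsWithin_iff_exists_mem_nhds_inter.1 hU'
  have hR0 : 0 ≤ R := by positivity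
  set N := M * ((R + 1) * K) with hN
  have hN0 : 0 ≤ N := by positivity
  have key : ∀ v₁ ∈ W, ∀ v₂ ∈ W, ∀ p₁ ∈ U ∩ D, ∀ p₂ ∈ U ∩ D,
      ⟪v₁ - P v₁ p₁, P v₂ p₂ - P v₁ p₁⟫ ≤ N * ‖p₁ - p₂‖ := by
    intro v₁ hv₁ v₂ hv₂ p₁ hp₁ p₂ hp₂
    have z₁ := hWU (Set.mk_mem_prod hv₁ (hUD hp₁))
    have z₂ := hWU (Set.mk_mem_prod hv₂ (hUD hp₂))
    obtain ⟨hT₁, hC₁, hR₁, S, hSI, hSact, l, hl, hlsum, hlM⟩ := z₁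
    obtain ⟨hT₂, hC₂, hR₂, -⟩ := z₂
    simp only at hT₁ hC₁ hR₁ hSact hlsum hT₂ hC₂ hR₂
    have hxC := (hC _ _).1 hC₂
    have h3 := aux_ineq (fun i => g i p₁) (fun i => g i p₂) (fun i => f i p₁) (fun i => f i p₂)
      I₁ I₂ B S hBI hSI (P v₁ p₁) (P v₂ p₂) hSact l hl hxC.1 hxC.2 R (K * ‖p₁ - p₂‖)
      (by positivity) hR₂ (hTg p₁ hT₁ p₂ hT₂) (hTf p₁ hT₁ p₂ hT₂)
    rw [hlsum] at h3
    refine h3.trans ?_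
    calc (∑ i ∈ S, |l i|) * ((R + 1) * (K * ‖p₁ - p₂‖))
        ≤ M * ((R + 1) * (K * ‖p₁ - p₂‖)) := by gcongr
      _ = N * ‖p₁ - p₂‖ := by rw [hN]; ring
  refine ⟨Real.sqrt (8 * N) + 1, by positivity, W, hW, U, hU, ?_⟩
  intro v₁ hv₁ v₂ hv₂ p₁ hp₁ p₂ hp₂
  have k1 := key v₁ hv₁ v₂ hv₂ p₁ hp₁ p₂ hp₂
  have k2 := key v₂ hv₂ v₁ hv₁ p₂ hp₂ p₁ hp₁
  rw [norm_sub_rev p₂ p₁] at k2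
  refine (aux_final v₁ v₂ _ _ N _ hN0 (norm_nonneg _) k1 k2).trans ?_
  gcongr
  linarith
end

section
/- Let H be a Hilbert space, D ⊂ G a subset of a normed space, and C(p) the polyhedral set defined by locally Lipschitz data f_i : D → ℝ, g_i : D → H for i ∈ I_1 ∪ I_2. Let p̄ ∈ D, v̄ ∉ C(p̄), and suppose LICQ holds for C(p̄) at x̄ = P(v̄,p̄), i.e., the vectors g_i(p̄), i ∈ I_{p̄}(x̄), are linearly independent. Then there exist neighbourhoods W of v̄ and U of p̄ and a constant ℓ⁰ > 0 such that ‖(v₁ − v₂) − 2[P(v₁,p₁) − P(v₂,p₂)]‖ ≤ ‖v₁ − v₂‖ + ℓ⁰‖p₁ − p₂‖ for all (v₁,p₁),(v₂,p₂) ∈ W × U; in particular P is locally Lipschitz at (v̄,p̄) with ‖P(v₁,p₁) − P(v₂,p₂)‖ ≤ ‖v₁ − v₂‖ + (ℓ⁰/2)‖p₁ − p₂‖. -/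
open RealInnerProductSpace

section Helpers

variable {H : Type*} [NormedAddCommGroup H] [InnerProductSpace ℝ H] {κ : Type*} [Fintype κ]

/-- polyhedron with equality constraints on `E` and inequality constraints elsewhere -/
def polyS (E : κ → Prop) (g : κ → H) (b : κ → ℝ) : Set H :=
  {x | ∀ i, ⟪x, g i⟫ ≤ b i ∧ (E i → ⟪x, g i⟫ = b i)}

/-- variational characterization of the projection -/
def IsPr (S : Set H) (v x : H) : Prop := x ∈ S ∧ ∀ y ∈ S, ⟪v - x, y - x⟫ ≤ 0

lemma polyS_convex (E : κ → Prop) (g : κ → H) (b : κ → ℝ) : Convex ℝ (polyS E g b) := by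
  intro x hx y hy s t hs ht hst i
  have h1 := hx i
  have h2 := hy i
  rw [inner_add_left, real_inner_smul_left, real_inner_smul_left]
  have hb : b i = s * b i + t * b i := by rw [← add_mul, hst, one_mul]
  constructor
  · rw [hb]
    exact add_le_add (mul_le_mul_of_nonneg_left h1.1 hs) (mul_le_mul_of_nonneg_left h2.1 ht)
  · intro hE
    rw [h1.2 hE, h2.2 hE, ← hb]

lemma polyS_closed (E : κ → Prop) (g : κ → H) (b : κ → ℝ) : IsClosed (polyS E g b) := by
  have : polyS E g b = ⋂ i, ({x | ⟪x, g i⟫ ≤ b i} ∩ {x | E i → ⟪x, g i⟫ = b i}) := by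
    ext x; simp [polyS]
  rw [this]
  refine isClosed_iInter fun i => IsClosed.inter ?_ ?_
  · exact isClosed_le (by fun_prop) continuous_const
  · by_cases hE : E i
    · simp only [hE, true_imp_iff]
      exact isClosed_eq (by fun_prop) continuous_const
    · simp [hE]

lemma exists_dual (g : κ → H) (hg : LinearIndependent ℝ g) (c : κ → ℝ) :
    ∃ z : H, ∀ i, ⟪z, g i⟫ = c i := by
  have : FiniteDimensional ℝ (Submodule.span ℝ (Set.range g)) :=
    FiniteDimensional.span_of_finite ℝ (Set.finite_range g)
  let φ : Submodule.span ℝ (Set.range g) →ₗ[ℝ] ℝ := (Module.Basis.span hg).constr ℝ c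
  let z := (InnerProductSpace.toDual ℝ (Submodule.span ℝ (Set.range g))).symm
    (LinearMap.toContinuousLinearMap φ)
  refine ⟨z, fun i => ?_⟩
  have h1 : ⟪z, Module.Basis.span hg i⟫ = φ (Module.Basis.span hg i) := by
    simp [z, InnerProductSpace.toDual_symm_apply]
  have h2 : φ (Module.Basis.span hg i) = c i := Module.Basis.constr_basis _ _ _ _
  rw [h2] at h1
  rw [← h1, Submodule.coe_inner, Module.Basis.span_apply]

lemma exists_pr [CompleteSpace H] (E : κ → Prop) (g : κ → H) (b : κ → ℝ)
    (hg : LinearIndependent ℝ g) (v : H) : ∃ x, IsPr (polyS E g b) v x := by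
  obtain ⟨z, hz⟩ := exists_dual g hg b
  have hne : (polyS E g b).Nonempty := ⟨z, fun i => ⟨(hz i).le, fun _ => hz i⟩⟩
  obtain ⟨x, hx, hx'⟩ := exists_norm_eq_iInf_of_complete_convex hne
    (polyS_closed E g b).isComplete (polyS_convex E g b) v
  exact ⟨x, hx, (norm_eq_iInf_iff_real_inner_le_zero (polyS_convex E g b) hx).1 hx'⟩

lemma kkt (E : κ → Prop) (g : κ → H) (b : κ → ℝ)
    (hg : LinearIndependent ℝ g) (v x : H) (hx : IsPr (polyS E g b) v x) :
    ∃ l : κ → ℝ, v - x = ∑ i, l i • g i ∧ (∀ i, ¬ E i → 0 ≤ l i) ∧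
      ∀ i, l i * (⟪x, g i⟫ - b i) = 0 := by
  classical
  have : FiniteDimensional ℝ (Submodule.span ℝ (Set.range g)) :=
    FiniteDimensional.span_of_finite ℝ (Set.finite_range g)
  have hw : v - x ∈ Submodule.span ℝ (Set.range g) := by
    rw [← Submodule.orthogonal_orthogonal (Submodule.span ℝ (Set.range g)),
      Submodule.mem_orthogonal']
    have key : ∀ u ∈ (Submodule.span ℝ (Set.range g))ᗮ, ⟪v - x, u⟫ ≤ 0 := by
      intro u hu
      have := hx.2 (x + u) (fun i => by
        have h0 : ⟪u, g i⟫ = 0 :=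
          (Submodule.mem_orthogonal' _ _).1 hu _ (Submodule.subset_span ⟨i, rfl⟩)
        rw [inner_add_left, h0, add_zero]
        exact hx.1 i)
      simpa using this
    intro u hu
    have h1 := key u hu
    have h2 := key (-u) (Submodule.neg_mem _ hu)
    rw [inner_neg_right] at h2
    linarith
  obtain ⟨l, hl⟩ := (Submodule.mem_span_range_iff_exists_fun ℝ).1 hw
  have hd : ∀ j, ∃ z : H, ∀ i, ⟪z, g i⟫ = if i = j then 1 else 0 :=
    fun j => exists_dual g hg _
  choose e he using hd
  have hle : ∀ j, ⟪v - x, e j⟫ = l j := by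
    intro j
    rw [← hl, sum_inner]
    have : ∀ i, ⟪l i • g i, e j⟫ = if i = j then l i else 0 := fun i => by
      rw [real_inner_smul_left, real_inner_comm, he]; simp
    simp only [this]
    simp
  have hpos : ∀ i, ¬ E i → 0 ≤ l i := by
    intro j hj
    have := hx.2 (x - e j) (fun i => by
      rw [inner_sub_left, he]
      by_cases hij : i = j
      · subst hij
        simp only [if_true, hj, false_imp_iff, and_true]
        linarith [(hx.1 i).1]
      · simpa [hij] using hx.1 i)
    rw [sub_sub_cancel_left, inner_neg_right, hle] at this
    linarith
  refine ⟨l, hl.symm, hpos, fun j => ?_⟩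
  by_cases hj : E j
  · rw [(hx.1 j).2 hj]; simp
  · have := hx.2 (x + (b j - ⟪x, g j⟫) • e j) (fun i => by
      rw [inner_add_left, real_inner_smul_left, he]
      by_cases hij : i = j
      · subst hij; simp
      · simpa [hij] using hx.1 i)
    rw [add_sub_cancel_left, real_inner_smul_right, hle] at this
    have h3 := mul_nonneg (sub_nonneg.2 (hx.1 j).1) (hpos j hj)
    linarith

lemma pr_estimate (E : κ → Prop) (g₁ g₂ : κ → H) (b₁ b₂ : κ → ℝ) (v x₁ x₂ : H)
    (hg₁ : LinearIndependent ℝ g₁) (hg₂ : LinearIndependent ℝ g₂)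
    (h₁ : IsPr (polyS E g₁ b₁) v x₁) (h₂ : IsPr (polyS E g₂ b₂) v x₂)
    (m R d : ℝ) (hm : 0 < m) (hd : 0 ≤ d)
    (hm₁ : ∀ c : κ → ℝ, m * ∑ i, |c i| ≤ ‖∑ i, c i • g₁ i‖)
    (hm₂ : ∀ c : κ → ℝ, m * ∑ i, |c i| ≤ ‖∑ i, c i • g₂ i‖)
    (hx₁ : ‖x₁‖ ≤ R) (hvx₁ : ‖v - x₁‖ ≤ R)
    (hdg : ∀ i, ‖g₂ i - g₁ i‖ ≤ d) (hdb : ∀ i, |b₂ i - b₁ i| ≤ d) :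
    ‖x₁ - x₂‖ ≤ 3 * ((R + 1) / m) * d := by
  obtain ⟨l, hl, hl0, hlc⟩ := kkt E g₁ b₁ hg₁ v x₁ h₁
  obtain ⟨k, hk, hk0, hkc⟩ := kkt E g₂ b₂ hg₂ v x₂ h₂
  set a := ‖x₁ - x₂‖ with ha
  have ha0 : 0 ≤ a := norm_nonneg _
  set c := (R + 1) / m with hc
  have hR : 0 ≤ R := (norm_nonneg _).trans hx₁
  have hc0 : 0 < c := by positivity
  have hcm : m * c = R + 1 := by rw [hc]; field_simp
  set M := ∑ i, |l i| with hM
  set T := ∑ i, |k i - l i| with hT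
  have hT0 : 0 ≤ T := Finset.sum_nonneg fun i _ => abs_nonneg _
  have hM0 : 0 ≤ M := Finset.sum_nonneg fun i _ => abs_nonneg _
  have hMc : M ≤ c := by
    have := hm₁ l
    rw [← hl] at this
    have h3 : m * M ≤ m * c := by rw [hcm]; linarith
    exact le_of_mul_le_mul_left h3 hm
  have hTb : m * T ≤ a + c * d := by
    have h3 := hm₂ (fun i => k i - l i)
    have h4 : ∑ i, (k i - l i) • g₂ i = (x₁ - x₂) - ∑ i, l i • (g₂ i - g₁ i) := by
      simp only [sub_smul, smul_sub, Finset.sum_sub_distrib]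
      rw [← hl, ← hk]; abel
    rw [h4] at h3
    have h5 : ‖∑ i, l i • (g₂ i - g₁ i)‖ ≤ M * d := by
      rw [hM, Finset.sum_mul]
      refine (norm_sum_le _ _).trans (Finset.sum_le_sum fun i _ => ?_)
      rw [norm_smul, Real.norm_eq_abs]
      exact mul_le_mul_of_nonneg_left (hdg i) (abs_nonneg _)
    have h6 := norm_sub_le (x₁ - x₂) (∑ i, l i • (g₂ i - g₁ i))
    have h7 := mul_le_mul_of_nonneg_right hMc hd
    linarith
  have hterm : ∀ i, k i * ⟪g₂ i, x₁ - x₂⟫ - l i * ⟪g₁ i, x₁ - x₂⟫ ≤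
      |k i - l i| * (d * (R + 1)) + |l i| * (d * a) := by
    intro i
    have e1 : k i * ⟪g₂ i, x₁ - x₂⟫ - l i * ⟪g₁ i, x₁ - x₂⟫ =
      (k i - l i) * (⟪g₂ i - g₁ i, x₁⟫ - (b₂ i - b₁ i)) + l i * ⟪g₂ i - g₁ i, x₁ - x₂⟫
      + k i * (⟪x₁, g₁ i⟫ - b₁ i) + l i * (⟪x₂, g₂ i⟫ - b₂ i)
      - k i * (⟪x₂, g₂ i⟫ - b₂ i) - l i * (⟪x₁, g₁ i⟫ - b₁ i) := by
      simp only [inner_sub_left, inner_sub_right, real_inner_comm (g₁ i), real_inner_comm (g₂ i)]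
      ring
    rw [e1, hlc, hkc]
    have s1 : k i * (⟪x₁, g₁ i⟫ - b₁ i) ≤ 0 := by
      by_cases hE : E i
      · rw [(h₁.1 i).2 hE]; simp
      · exact mul_nonpos_of_nonneg_of_nonpos (hk0 i hE) (sub_nonpos.2 (h₁.1 i).1)
    have s2 : l i * (⟪x₂, g₂ i⟫ - b₂ i) ≤ 0 := by
      by_cases hE : E i
      · rw [(h₂.1 i).2 hE]; simp
      · exact mul_nonpos_of_nonneg_of_nonpos (hl0 i hE) (sub_nonpos.2 (h₂.1 i).1)
    have s3 : (k i - l i) * (⟪g₂ i - g₁ i, x₁⟫ - (b₂ i - b₁ i)) ≤ |k i - l i| * (d * (R + 1)) := by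
      refine (le_abs_self _).trans ?_
      rw [abs_mul]
      refine mul_le_mul_of_nonneg_left ?_ (abs_nonneg _)
      refine (abs_sub _ _).trans ?_
      have := (abs_real_inner_le_norm (g₂ i - g₁ i) x₁).trans
        (mul_le_mul (hdg i) hx₁ (norm_nonneg _) hd)
      linarith [hdb i]
    have s4 : l i * ⟪g₂ i - g₁ i, x₁ - x₂⟫ ≤ |l i| * (d * a) := by
      refine (le_abs_self _).trans ?_
      rw [abs_mul]
      refine mul_le_mul_of_nonneg_left ?_ (abs_nonneg _)
      exact (abs_real_inner_le_norm _ _).trans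
        (mul_le_mul_of_nonneg_right (hdg i) (norm_nonneg _))
    linarith
  have hsq : a * a ≤ T * (d * (R + 1)) + M * (d * a) := by
    have e2 : a * a = ∑ i, (k i * ⟪g₂ i, x₁ - x₂⟫ - l i * ⟪g₁ i, x₁ - x₂⟫) := by
      rw [ha, ← real_inner_self_eq_norm_mul_norm]
      have h8 : ⟪x₁ - x₂, x₁ - x₂⟫ = ⟪v - x₂, x₁ - x₂⟫ - ⟪v - x₁, x₁ - x₂⟫ := by
        rw [← inner_sub_left]; congr 1; abel
      rw [h8, hk, hl, sum_inner, sum_inner, ← Finset.sum_sub_distrib]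
      simp only [real_inner_smul_left]
    rw [e2, hT, hM, Finset.sum_mul, Finset.sum_mul, ← Finset.sum_add_distrib]
    exact Finset.sum_le_sum fun i _ => hterm i
  have hfin : a * a ≤ c * d * (a + c * d) + c * d * a := by
    have t1 : T * (d * (R + 1)) ≤ c * d * (a + c * d) := by
      rw [← hcm]
      have := mul_le_mul_of_nonneg_left hTb (mul_nonneg hc0.le hd)
      linarith
    have t2 : M * (d * a) ≤ c * d * a := by
      have := mul_le_mul_of_nonneg_right hMc (mul_nonneg hd ha0)
      linarith
    linarith
  have hcd : 0 ≤ c * d := mul_nonneg hc0.le hd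
  by_contra hcon
  push Not at hcon
  nlinarith

lemma uli_li (g : κ → H) (m : ℝ) (hm : 0 < m)
    (h : ∀ c : κ → ℝ, m * ∑ i, |c i| ≤ ‖∑ i, c i • g i‖) : LinearIndependent ℝ g := by
  rw [Fintype.linearIndependent_iff]
  intro c hc i
  have h1 := h c
  rw [hc, norm_zero] at h1
  have h2 : |c i| ≤ ∑ i, |c i| :=
    Finset.single_le_sum (f := fun i => |c i|) (fun i _ => abs_nonneg _) (Finset.mem_univ i)
  have h3 : |c i| ≤ 0 := by
    by_contra h4
    push Not at h4
    nlinarith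
  exact abs_nonpos_iff.1 h3

lemma li_uli (g : κ → H) (hg : LinearIndependent ℝ g) :
    ∃ m > 0, ∀ c : κ → ℝ, m * ∑ i, |c i| ≤ ‖∑ i, c i • g i‖ := by
  have hk : LinearMap.ker (Fintype.linearCombination ℝ g) = ⊥ := by
    rw [LinearMap.ker_eq_bot]
    exact hg.fintypeLinearCombination_injective
  obtain ⟨K, hK, hK'⟩ := (Fintype.linearCombination ℝ g).exists_antilipschitzWith hk
  have hK0 : (0 : ℝ) < K := hK
  have hN : (0 : ℝ) < (Fintype.card κ : ℝ) + 1 := by positivity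
  refine ⟨1 / (((Fintype.card κ : ℝ) + 1) * K), by positivity, fun c => ?_⟩
  have h1 : ‖c‖ ≤ K * ‖∑ i, c i • g i‖ := by
    have := hK'.le_mul_dist c 0
    simpa [Fintype.linearCombination_apply, dist_eq_norm] using this
  have h2 : ∑ i, |c i| ≤ ((Fintype.card κ : ℝ) + 1) * ‖c‖ := by
    calc ∑ i, |c i| ≤ ∑ i : κ, ‖c‖ := Finset.sum_le_sum fun i _ => norm_le_pi_norm c i
      _ = (Fintype.card κ : ℝ) * ‖c‖ := by simp
      _ ≤ _ := by nlinarith [norm_nonneg c]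
  rw [div_mul_eq_mul_div, one_mul, div_le_iff₀ (by positivity)]
  calc _ ≤ _ := h2
    _ ≤ ((Fintype.card κ : ℝ) + 1) * (K * ‖∑ i, c i • g i‖) := by gcongr
    _ = _ := by ring

lemma uli_perturb (g g' : κ → H) (m : ℝ)
    (h : ∀ c : κ → ℝ, m * ∑ i, |c i| ≤ ‖∑ i, c i • g i‖) (h' : ∀ i, ‖g i - g' i‖ ≤ m / 2)
    (c : κ → ℝ) : m / 2 * ∑ i, |c i| ≤ ‖∑ i, c i • g' i‖ := by
  have h1 : ∑ i, c i • g i = ∑ i, c i • g' i + ∑ i, c i • (g i - g' i) := by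
    simp only [smul_sub, Finset.sum_sub_distrib]; abel
  have h2 : ‖∑ i, c i • (g i - g' i)‖ ≤ m / 2 * ∑ i, |c i| := by
    rw [Finset.mul_sum]
    refine (norm_sum_le _ _).trans (Finset.sum_le_sum fun i _ => ?_)
    rw [norm_smul, Real.norm_eq_abs, mul_comm]
    exact mul_le_mul_of_nonneg_right (h' i) (abs_nonneg _)
  have h3 := h c
  rw [h1] at h3
  have := norm_add_le (∑ i, c i • g' i) (∑ i, c i • (g i - g' i))
  linarith

lemma pr_refl (S : Set H) (v₁ v₂ x₁ x₂ : H) (h₁ : IsPr S v₁ x₁) (h₂ : IsPr S v₂ x₂) :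
    ‖(v₁ - v₂) - (2 : ℝ) • (x₁ - x₂)‖ ≤ ‖v₁ - v₂‖ := by
  have a := h₁.2 x₂ h₂.1
  have b := h₂.2 x₁ h₁.1
  have e : ⟪v₁ - x₁, x₂ - x₁⟫ + ⟪v₂ - x₂, x₁ - x₂⟫
      = ‖x₁ - x₂‖ ^ 2 - ⟪v₁ - v₂, x₁ - x₂⟫ := by
    rw [← real_inner_self_eq_norm_sq]
    simp only [inner_sub_left, inner_sub_right]; ring
  have h3 := norm_sub_sq_real (v₁ - v₂) ((2 : ℝ) • (x₁ - x₂))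
  rw [real_inner_smul_right, norm_smul, mul_pow] at h3
  norm_num at h3
  refine (sq_le_sq₀ (norm_nonneg _) (norm_nonneg _)).1 ?_
  linarith

lemma pr_unique (S : Set H) (v q x : H) (hq : IsPr S v q) (hx : x ∈ S)
    (hle : ‖x - v‖ ≤ ‖q - v‖) : x = q := by
  have a := hq.2 x hx
  have h3 := norm_add_sq_real (x - q) (q - v)
  rw [sub_add_sub_cancel] at h3
  have h4 : ⟪x - q, q - v⟫ = - ⟪v - q, x - q⟫ := by
    rw [← inner_neg_left, neg_sub, real_inner_comm]
  rw [h4] at h3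
  have h5 : ‖x - v‖ ^ 2 ≤ ‖q - v‖ ^ 2 := pow_le_pow_left₀ (norm_nonneg _) hle 2
  have h6 : ‖x - q‖ ^ 2 = 0 := le_antisymm (by linarith) (sq_nonneg _)
  exact sub_eq_zero.1 (norm_eq_zero.1 (pow_eq_zero_iff two_ne_zero |>.1 h6))

lemma local_min_pr (v x u : H)
    (h : ∀ᶠ t : ℝ in nhdsWithin 0 (Set.Ioi 0), ‖x - v‖ ≤ ‖(x + t • u) - v‖) :
    ⟪v - x, u⟫ ≤ 0 := by
  have h1 : ∀ᶠ t : ℝ in nhdsWithin 0 (Set.Ioi 0), 2 * ⟪v - x, u⟫ ≤ t * ‖u‖ ^ 2 := by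
    filter_upwards [h, self_mem_nhdsWithin] with t ht ht0
    have ht0 : 0 < t := ht0
    have e : (x + t • u) - v = (x - v) + t • u := by abel
    rw [e] at ht
    have h5 : ‖x - v‖ ^ 2 ≤ ‖(x - v) + t • u‖ ^ 2 := pow_le_pow_left₀ (norm_nonneg _) ht 2
    rw [norm_add_sq_real, real_inner_smul_right, norm_smul, mul_pow, Real.norm_eq_abs,
      sq_abs, ← neg_sub v x, inner_neg_left] at h5
    have h6 : 0 ≤ t * (t * ‖u‖ ^ 2 - 2 * ⟪v - x, u⟫) := by
      simp only [norm_neg] at h5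
      nlinarith
    have := nonneg_of_mul_nonneg_right h6 ht0
    linarith
  have h2 : Filter.Tendsto (fun t : ℝ => t * ‖u‖ ^ 2) (nhdsWithin 0 (Set.Ioi 0)) (nhds 0) := by
    have : Filter.Tendsto (fun t : ℝ => t * ‖u‖ ^ 2) (nhds 0) (nhds (0 * ‖u‖ ^ 2)) :=
      Continuous.tendsto (by fun_prop) 0
    rw [zero_mul] at this
    exact this.mono_left nhdsWithin_le_nhds
  have := ge_of_tendsto h2 h1
  linarith

end Helpers

/-- Under LICQ at `xbar = P(vbar,pbar)` and locally Lipschitz data, the projection onto the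
moving polyhedral set satisfies the Lipschitzian stability estimate; in particular `P`
is locally Lipschitz at `(vbar, pbar)`. -/
theorem stmt_18 {H G : Type*} [NormedAddCommGroup H] [InnerProductSpace ℝ H]
    [CompleteSpace H] [NormedAddCommGroup G] [NormedSpace ℝ G]
    (D : Set G) {ι : Type*} [Fintype ι] (I₁ I₂ : Finset ι)
    (f : ι → G → ℝ) (g : ι → G → H)
    (C : G → Set H)
    (hCdef : ∀ p, C p = {x : H | (∀ i ∈ I₁, ⟪x, g i p⟫ = f i p) ∧
      (∀ i ∈ I₂, ⟪x, g i p⟫ ≤ f i p)})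
    (hLip : ∀ i, ∀ p ∈ D, ∃ K : NNReal, ∃ t ∈ nhdsWithin p D,
      LipschitzOnWith K (f i) t ∧ LipschitzOnWith K (g i) t)
    (pbar : G) (hpbar : pbar ∈ D) (vbar : H) (hvbar : vbar ∉ C pbar)
    -- P(v,p) is the metric projection of v onto C(p)
    (P : H → G → H)
    (hP : ∀ v : H, ∀ p ∈ D, (C p).Nonempty →
      P v p ∈ C p ∧ ∀ y ∈ C p, ‖P v p - v‖ ≤ ‖y - v‖)
    (xbar : H) (hxbarP : xbar = P vbar pbar) (hxbarC : xbar ∈ C pbar)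
    -- LICQ: the active constraint normals at (pbar, xbar) are linearly independent
    (hLICQ : LinearIndependent ℝ
      (fun i : {i : ι // (i ∈ I₁ ∨ i ∈ I₂) ∧ ⟪xbar, g i pbar⟫ = f i pbar} => g i.1 pbar)) :
    ∃ ℓ₀ > (0 : ℝ), ∃ W ∈ nhds vbar, ∃ U ∈ nhds pbar,
      ∀ v₁ ∈ W, ∀ v₂ ∈ W, ∀ p₁ ∈ U ∩ D, ∀ p₂ ∈ U ∩ D,
        ‖(v₁ - v₂) - (2 : ℝ) • (P v₁ p₁ - P v₂ p₂)‖ ≤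
          ‖v₁ - v₂‖ + ℓ₀ * ‖p₁ - p₂‖ ∧
        ‖P v₁ p₁ - P v₂ p₂‖ ≤ ‖v₁ - v₂‖ + (ℓ₀ / 2) * ‖p₁ - p₂‖ := by
  classical
  have hLip' : ∃ K : ℝ, 0 ≤ K ∧ ∃ r > 0, ∀ i, ∀ p₁ ∈ D, ∀ p₂ ∈ D, ‖p₁ - pbar‖ < r →
      ‖p₂ - pbar‖ < r → ‖g i p₁ - g i p₂‖ ≤ K * ‖p₁ - p₂‖ ∧
        |f i p₁ - f i p₂| ≤ K * ‖p₁ - p₂‖ := by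
    choose K t ht hKt using fun i => hLip i pbar hpbar
    have hall : (⋂ i, t i) ∈ nhdsWithin pbar D := Filter.iInter_mem.2 ht
    obtain ⟨r, hr, hrt⟩ := Metric.mem_nhdsWithin_iff.1 hall
    refine ⟨∑ i, (K i : ℝ), Finset.sum_nonneg fun i _ => (K i).2, r, hr, ?_⟩
    intro i p₁ hp₁ p₂ hp₂ h₁ h₂
    have m₁ : p₁ ∈ t i := Set.mem_iInter.1 (hrt ⟨by simpa [dist_eq_norm] using h₁, hp₁⟩) i
    have m₂ : p₂ ∈ t i := Set.mem_iInter.1 (hrt ⟨by simpa [dist_eq_norm] using h₂, hp₂⟩) i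
    have hKi : (K i : ℝ) ≤ ∑ i, (K i : ℝ) :=
      Finset.single_le_sum (f := fun i => (K i : ℝ)) (fun i _ => (K i).2) (Finset.mem_univ i)
    have hKm := mul_le_mul_of_nonneg_right hKi (norm_nonneg (p₁ - p₂))
    have d₁ := (hKt i).1.dist_le_mul p₁ m₁ p₂ m₂
    have d₂ := (hKt i).2.dist_le_mul p₁ m₁ p₂ m₂
    rw [dist_eq_norm, dist_eq_norm] at d₁ d₂
    rw [Real.norm_eq_abs] at d₁
    exact ⟨d₂.trans hKm, d₁.trans hKm⟩
  obtain ⟨K, hK0, r, hr, hKr⟩ := hLip'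
  -- the reduced system
  let κ := {i : ι // (i ∈ I₁ ∨ i ∈ I₂) ∧ ⟪xbar, g i pbar⟫ = f i pbar}
  let E : κ → Prop := fun i => i.1 ∈ I₁
  let S : G → Set H := fun p => polyS E (fun i : κ => g i.1 p) (fun i : κ => f i.1 p)
  have hxC := hxbarC
  rw [hCdef] at hxC
  have hCS : ∀ p, C p ⊆ S p := by
    intro p x hx i
    rw [hCdef] at hx
    refine ⟨?_, fun h => hx.1 _ h⟩
    rcases i.2.1 with h | h
    · exact (hx.1 _ h).le
    · exact hx.2 _ h
  have hSC : ∀ p x, x ∈ S p → (∀ i ∈ I₂, ⟪xbar, g i pbar⟫ < f i pbar → ⟪x, g i p⟫ ≤ f i p) →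
      x ∈ C p := by
    intro p x hx hi
    rw [hCdef]
    refine ⟨fun i h => (hx ⟨i, Or.inl h, hxC.1 i h⟩).2 h, fun i h => ?_⟩
    rcases (hxC.2 i h).lt_or_eq with h' | h'
    · exact hi i h h'
    · exact (hx ⟨i, Or.inr h, h'⟩).1
  have hSconv : ∀ p, Convex ℝ (S p) := fun p => polyS_convex _ _ _
  -- inactive constraints stay inactive
  have hin : ∃ ε > 0, ε ≤ 1 ∧ ∃ ρ > 0, ρ ≤ r ∧ ∀ q : H, ∀ p ∈ D, ‖q - xbar‖ < ε → ‖p - pbar‖ < ρ →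
      ∀ i ∈ I₂, ⟪xbar, g i pbar⟫ < f i pbar → ⟪q, g i p⟫ ≤ f i p := by
    have hev : ∀ᶠ z : H × G in nhds xbar ×ˢ nhdsWithin pbar D,
        ∀ i, ⟪xbar, g i pbar⟫ < f i pbar → ⟪z.1, g i z.2⟫ ≤ f i z.2 := by
      rw [Filter.eventually_all]
      intro i
      by_cases hlt : ⟪xbar, g i pbar⟫ < f i pbar
      · obtain ⟨Ki, t, ht, hf, hg⟩ := hLip i pbar hpbar
        have hmem : pbar ∈ t := mem_of_mem_nhdsWithin hpbar ht
        have cg : Filter.Tendsto (g i) (nhdsWithin pbar D) (nhds (g i pbar)) :=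
          (hg.continuousOn pbar hmem).mono_left (nhdsWithin_le_iff.2 ht)
        have cf : Filter.Tendsto (f i) (nhdsWithin pbar D) (nhds (f i pbar)) :=
          (hf.continuousOn pbar hmem).mono_left (nhdsWithin_le_iff.2 ht)
        have c1 : Filter.Tendsto (fun z : H × G => ⟪z.1, g i z.2⟫)
            (nhds xbar ×ˢ nhdsWithin pbar D) (nhds ⟪xbar, g i pbar⟫) :=
          Filter.Tendsto.inner Filter.tendsto_fst (cg.comp Filter.tendsto_snd)
        have c2 : Filter.Tendsto (fun z : H × G => f i z.2)
            (nhds xbar ×ˢ nhdsWithin pbar D) (nhds (f i pbar)) :=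
          cf.comp Filter.tendsto_snd
        filter_upwards [c1.eventually_lt c2 hlt] with z hz _ using hz.le
      · exact Filter.Eventually.of_forall fun z h => absurd h hlt
    obtain ⟨A, hA, B, hB, hAB⟩ := Filter.mem_prod_iff.1 hev
    obtain ⟨ε, hε, hεA⟩ := Metric.mem_nhds_iff.1 hA
    obtain ⟨ρ, hρ, hρB⟩ := Metric.mem_nhdsWithin_iff.1 hB
    refine ⟨min ε 1, by positivity, min_le_right _ _, min ρ r, by positivity,
      min_le_right _ _, ?_⟩
    intro q p hp hq hpp i _ hi
    exact hAB (Set.mk_mem_prod (hεA (by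
      simpa [dist_eq_norm] using hq.trans_le (min_le_left _ _)))
      (hρB ⟨by simpa [dist_eq_norm] using hpp.trans_le (min_le_left _ _), hp⟩)) i hi
  obtain ⟨ε, hε, hε1, ρ, hρ, hρr, hina⟩ := hin
  obtain ⟨m', hm', hml'⟩ := li_uli (fun i : κ => g i.1 pbar) hLICQ
  set m := m' / 2 with hmdef
  have hm : 0 < m := by positivity
  set R := ‖vbar‖ + ‖xbar‖ + 2 with hR
  set c := (R + 1) / m with hc
  have hRpos : 0 < R := by positivity
  have hcpos : 0 < c := by positivity
  -- xbar is the projection of vbar onto S pbar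
  have hxpr : IsPr (S pbar) vbar xbar := by
    refine ⟨hCS _ hxbarC, fun y hy => local_min_pr _ _ _ ?_⟩
    have ht : Filter.Tendsto (fun t : ℝ => xbar + t • (y - xbar)) (nhds 0) (nhds xbar) := by
      have : Filter.Tendsto (fun t : ℝ => xbar + t • (y - xbar)) (nhds 0)
          (nhds (xbar + (0 : ℝ) • (y - xbar))) := Continuous.tendsto (by fun_prop) 0
      simpa using this
    have hb : ∀ᶠ t : ℝ in nhdsWithin 0 (Set.Ioi 0),
        xbar + t • (y - xbar) ∈ Metric.ball xbar ε :=
      nhdsWithin_le_nhds (ht.eventually (Metric.ball_mem_nhds xbar hε))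
    have h1 : ∀ᶠ t : ℝ in nhdsWithin 0 (Set.Ioi 0), t < 1 :=
      nhdsWithin_le_nhds (Iio_mem_nhds zero_lt_one)
    filter_upwards [hb, h1, self_mem_nhdsWithin] with t htb ht1 ht0
    have ht0 : 0 < t := ht0
    have hmem : xbar + t • (y - xbar) ∈ C pbar := by
      refine hSC _ _ ?_ (hina _ pbar hpbar (by simpa [dist_eq_norm] using htb) (by simpa using hρ))
      exact (hSconv pbar).add_smul_sub_mem (hCS _ hxbarC) hy ⟨ht0.le, ht1.le⟩
    have := (hP vbar pbar hpbar ⟨xbar, hxbarC⟩).2 _ hmem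
    rwa [← hxbarP] at this
  set σ := min ρ (min (m / (K + 1)) (ε / 2 / (3 * c * (K + 1)))) with hσ
  have hσpos : 0 < σ := by positivity
  have hσρ : σ ≤ ρ := min_le_left _ _
  have huli : ∀ p ∈ D, ‖p - pbar‖ < σ → ∀ a : κ → ℝ, m * ∑ i, |a i| ≤ ‖∑ i, a i • g i.1 p‖ := by
    intro p hp hps
    refine uli_perturb (fun i : κ => g i.1 pbar) (fun i : κ => g i.1 p) m' hml' fun i => ?_
    have h1 := (hKr i.1 pbar hpbar p hp (by simpa using hr) (by linarith)).1
    rw [norm_sub_rev pbar p] at h1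
    have h2 : ‖p - pbar‖ < m / (K + 1) :=
      hps.trans_le ((min_le_right _ _).trans (min_le_left _ _))
    rw [lt_div_iff₀ (by positivity)] at h2
    refine h1.trans ?_
    nlinarith [norm_nonneg (p - pbar)]
  have hli : ∀ p ∈ D, ‖p - pbar‖ < σ → LinearIndependent ℝ (fun i : κ => g i.1 p) :=
    fun p hp hps => uli_li _ m hm (huli p hp hps)
  have hest : ∀ p₁ ∈ D, ∀ p₂ ∈ D, ‖p₁ - pbar‖ < σ → ‖p₂ - pbar‖ < σ → ∀ v x₁ x₂,
      ‖v - vbar‖ ≤ 1 → ‖x₁ - xbar‖ ≤ 1 → IsPr (S p₁) v x₁ → IsPr (S p₂) v x₂ →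
      ‖x₁ - x₂‖ ≤ 3 * c * (K * ‖p₁ - p₂‖) := by
    intro p₁ hp₁ p₂ hp₂ hs₁ hs₂ v x₁ x₂ hv hx₁ hpr₁ hpr₂
    have n1 : ‖x₁‖ ≤ ‖xbar‖ + 1 := by
      have := norm_add_le (x₁ - xbar) xbar
      rw [sub_add_cancel] at this
      linarith
    have n2 : ‖v‖ ≤ ‖vbar‖ + 1 := by
      have := norm_add_le (v - vbar) vbar
      rw [sub_add_cancel] at this
      linarith
    have n3 := norm_sub_le v x₁
    have hd := fun i => hKr i p₂ hp₂ p₁ hp₁ (by linarith) (by linarith)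
    rw [norm_sub_rev p₂ p₁] at hd
    exact pr_estimate E _ _ _ _ v x₁ x₂ (hli p₁ hp₁ hs₁) (hli p₂ hp₂ hs₂) hpr₁ hpr₂ m R _ hm
      (by positivity) (huli p₁ hp₁ hs₁) (huli p₂ hp₂ hs₂)
      (by linarith [norm_nonneg vbar]) (by linarith)
      (fun i => (hd i.1).1) (fun i => (hd i.1).2)
  have hnear : ∀ p ∈ D, ‖p - pbar‖ < σ → ∀ v, ‖v - vbar‖ < ε / 2 → ∀ x, IsPr (S p) v x →
      ‖x - xbar‖ < ε := by
    intro p hp hps v hv x hx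
    obtain ⟨q, hq⟩ := exists_pr E (fun i : κ => g i.1 p) (fun i : κ => f i.1 p) (hli p hp hps) vbar
    have e1 := hest pbar hpbar p hp (by simpa using hσpos) hps vbar xbar q (by simp) (by simp)
      hxpr hq
    have e2 := pr_refl (S p) v vbar x q hx hq
    have e3 : ‖x - q‖ ≤ ‖v - vbar‖ := by
      have h := norm_sub_le (v - vbar) ((v - vbar) - (2 : ℝ) • (x - q))
      rw [sub_sub_cancel, norm_smul] at h
      norm_num at h
      linarith
    have e4 : 3 * c * (K * ‖pbar - p‖) ≤ ε / 2 := by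
      rw [norm_sub_rev]
      have h2 : ‖p - pbar‖ < ε / 2 / (3 * c * (K + 1)) :=
        hps.trans_le ((min_le_right _ _).trans (min_le_right _ _))
      rw [lt_div_iff₀ (by positivity)] at h2
      have : 0 ≤ 3 * c * ‖p - pbar‖ := by positivity
      linarith
    have e5 := norm_sub_le (x - q) (xbar - q)
    rw [sub_sub_sub_cancel_right] at e5
    linarith
  have hmainP : ∀ p ∈ D, ‖p - pbar‖ < σ → ∀ v, ‖v - vbar‖ < ε / 2 →
      IsPr (S p) v (P v p) := by
    intro p hp hps v hv
    obtain ⟨q, hq⟩ := exists_pr E (fun i : κ => g i.1 p) (fun i : κ => f i.1 p) (hli p hp hps) v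
    have hqC : q ∈ C p := hSC p q hq.1 (hina q p hp (hnear p hp hps v hv q hq) (by linarith))
    obtain ⟨hp1, hp2⟩ := hP v p hp ⟨q, hqC⟩
    rw [pr_unique (S p) v q (P v p) hq (hCS p hp1) (hp2 q hqC)]
    exact hq
  refine ⟨2 * (3 * c * K) + 1, by positivity, Metric.ball vbar (ε / 2),
    Metric.ball_mem_nhds _ (by positivity), Metric.ball pbar σ, Metric.ball_mem_nhds _ hσpos, ?_⟩
  rintro v₁ hv₁ v₂ hv₂ p₁ ⟨hp₁, hpD₁⟩ p₂ ⟨hp₂, hpD₂⟩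
  rw [Metric.mem_ball, dist_eq_norm] at hv₁ hv₂ hp₁ hp₂
  have q11 := hmainP p₁ hpD₁ hp₁ v₁ hv₁
  have q21 := hmainP p₁ hpD₁ hp₁ v₂ hv₂
  have q22 := hmainP p₂ hpD₂ hp₂ v₂ hv₂
  have f1 := pr_refl (S p₁) v₁ v₂ _ _ q11 q21
  have f2 := hest p₁ hpD₁ p₂ hpD₂ hp₁ hp₂ v₂ _ _ (by linarith)
    ((hnear p₁ hpD₁ hp₁ v₂ hv₂ _ q21).le.trans hε1) q21 q22
  have f3 : ‖(v₁ - v₂) - (2 : ℝ) • (P v₁ p₁ - P v₂ p₂)‖ ≤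
      ‖v₁ - v₂‖ + (2 * (3 * c * K) + 1) * ‖p₁ - p₂‖ := by
    have e : (v₁ - v₂) - (2 : ℝ) • (P v₁ p₁ - P v₂ p₂) =
        ((v₁ - v₂) - (2 : ℝ) • (P v₁ p₁ - P v₂ p₁)) - (2 : ℝ) • (P v₂ p₁ - P v₂ p₂) := by
      module
    have h := norm_sub_le ((v₁ - v₂) - (2 : ℝ) • (P v₁ p₁ - P v₂ p₁))
      ((2 : ℝ) • (P v₂ p₁ - P v₂ p₂))
    rw [← e, norm_smul] at h
    norm_num at h
    linarith [norm_nonneg (p₁ - p₂)]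
  refine ⟨f3, ?_⟩
  have h := norm_sub_le (v₁ - v₂) ((v₁ - v₂) - (2 : ℝ) • (P v₁ p₁ - P v₂ p₂))
  rw [sub_sub_cancel, norm_smul] at h
  norm_num at h
  linarith
end
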